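/- Let α be a C*-partial action of a discrete group G on a C*-algebra A satisfying property (NS), and define F_t(a,b) := lim_i α_t(u_i a) b for any approximate unit (u_i) of A_{t⁻¹}. Then (F_t)_{t∈G} is an enveloping family of functions for α; in particular F_t(a,b)* = α_t(F_{t⁻¹}(b*, a*)) for all a, b ∈ A, t ∈ G. -/

import Mathlib

set_option linter.unusedSectionVars false
set_option linter.unusedVariables false

universe u v w x y

section PartialActionPrelim

variable (k : Type u) [CommRing k] (G : Type v) [Group G] (A : Type w)
  [NonUnitalRing A] [Module k A] [SMulCommClass k A A] [IsScalarTower k A A]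

/-- A partial action of a group `G` on a (not necessarily unital) `k`-algebra `A`:
a family of two-sided ideals `A_t` and algebra isomorphisms `α_t : A_{t⁻¹} → A_t`
(encoded by total functions `act t : A → A` whose behaviour only matters on `A_{t⁻¹}`). -/
structure AlgPartialAction : Type (max u v w) where
  ideal : G → Submodule k A
  act : G → A → A
  mul_mem_left : ∀ (t : G) (a : A), ∀ x ∈ ideal t, a * x ∈ ideal t
  mul_mem_right : ∀ (t : G) (a : A), ∀ x ∈ ideal t, x * a ∈ ideal t
  ideal_one : ideal 1 = ⊤
  act_one : ∀ a : A, act 1 a = a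
  act_mem : ∀ t : G, ∀ a ∈ ideal t⁻¹, act t a ∈ ideal t
  act_add : ∀ t : G, ∀ a ∈ ideal t⁻¹, ∀ b ∈ ideal t⁻¹, act t (a + b) = act t a + act t b
  act_smul : ∀ (t : G) (c : k), ∀ a ∈ ideal t⁻¹, act t (c • a) = c • act t a
  act_mul : ∀ t : G, ∀ a ∈ ideal t⁻¹, ∀ b ∈ ideal t⁻¹, act t (a * b) = act t a * act t b
  act_injOn : ∀ t : G, Set.InjOn (act t) (ideal t⁻¹ : Set A)
  act_image : ∀ s t : G,
    act t '' ((ideal t⁻¹ : Set A) ∩ (ideal s : Set A)) = (ideal t : Set A) ∩ (ideal (t * s) : Set A)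
  act_comp : ∀ s t : G, ∀ a ∈ ideal t⁻¹, act t a ∈ ideal s⁻¹ → act s (act t a) = act (s * t) a

/-- The annihilator `Ann(B) = {b ∈ B : bB = Bb = 0}`. -/
def annih (B : Type x) [NonUnitalRing B] : Set B := {b | ∀ c : B, b * c = 0 ∧ c * b = 0}

variable {k G A}

/-- An enveloping pair `(μ, β)` for a partial action `α` (in the purely algebraic sense). -/
structure EnvPair (α : AlgPartialAction k G A) (B : Type x) [NonUnitalRing B]
    [Module k B] [SMulCommClass k B B] [IsScalarTower k B B] : Type (max u v w x) where
  β : G → B →ₙₐ[k] B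
  β_one : ∀ b : B, β 1 b = b
  β_comp : ∀ (s t : G) (b : B), β (s * t) b = β s (β t b)
  μ : A →ₙₐ[k] B
  μ_inj : Function.Injective μ
  μ_mul_mem_left : ∀ b : B, ∀ x ∈ Set.range μ, b * x ∈ Set.range μ
  μ_mul_mem_right : ∀ b : B, ∀ x ∈ Set.range μ, x * b ∈ Set.range μ
  inter : ∀ t : G, ⇑μ '' (α.ideal t : Set A) = Set.range μ ∩ (⇑(β t) '' Set.range μ)
  equivar : ∀ t : G, ∀ a ∈ α.ideal t⁻¹, β t (μ a) = μ (α.act t a)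
  spans : Submodule.span k (⋃ t : G, ⇑(β t) '' Set.range μ) = ⊤

/-- An enveloping family of functions for a partial action `α` (Definition 1.7). -/
structure IsEnvFamily (α : AlgPartialAction k G A) (F : G → A → A → A) : Prop where
  mem : ∀ (t : G) (a b : A), F t a b ∈ α.ideal t
  add_left : ∀ (t : G) (a a' b : A), F t (a + a') b = F t a b + F t a' b
  add_right : ∀ (t : G) (a b b' : A), F t a (b + b') = F t a b + F t a b'
  smul_left : ∀ (t : G) (c : k) (a b : A), F t (c • a) b = c • F t a b
  smul_right : ∀ (t : G) (c : k) (a b : A), F t a (c • b) = c • F t a b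
  F_one : ∀ a b : A, F 1 a b = a * b
  cond2a : ∀ (t : G) (a b c : A), F t a (b * c) = F t a b * c
  cond2b : ∀ (t : G) (a b c : A), α.act t (F t⁻¹ (a * b) c) = a * α.act t (F t⁻¹ b c)
  cond2c : ∀ (t : G) (a b c : A), a * F t b c = α.act t (F t⁻¹ a b) * c
  cond3a : ∀ (s t : G) (a b c : A), F t (F s a b) c = F (t * s) a (F t b c)
  cond3b : ∀ (s t : G) (a b c : A), F t (α.act s⁻¹ (F s a b)) c = F t a (F (t * s⁻¹) b c)
  cond4 : ∀ a : A, a = 0 ↔ ∀ (t : G) (b : A), F t a b = 0 ∧ F t b a = 0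
  cond5a : ∀ (s t : G) (b : A), ∀ a ∈ α.ideal t⁻¹, F (s * t) a b = F s (α.act t a) b
  cond5b : ∀ (s t : G) (b : A), ∀ a ∈ α.ideal t⁻¹,
    α.act (s * t) (F (t⁻¹ * s⁻¹) b a) = α.act s (F s⁻¹ b (α.act t a))
  cond6 : ∀ (t : G) (a : A),
    (∃ b : A, ∀ (s : G) (c : A), F s a c = F (s * t) b c ∧ F s c a = α.act t (F (t⁻¹ * s) c b)) →
    a ∈ α.ideal t

end PartialActionPrelim

section CStarPrelim

variable (G : Type u) [Group G] (A : Type v) [NonUnitalCStarAlgebra A]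

/-- A C*-partial action of a (discrete) group `G` on a C*-algebra `A`: an algebraic partial
action whose ideals are closed and whose partial maps are *-preserving (i.e. *-isomorphisms
`A_{t⁻¹} → A_t`). -/
structure CStarPartialAction extends AlgPartialAction ℂ G A : Type (max u v) where
  ideal_closed : ∀ t : G, IsClosed (toAlgPartialAction.ideal t : Set A)
  act_star : ∀ t : G, ∀ a ∈ toAlgPartialAction.ideal t⁻¹,
    toAlgPartialAction.act t (star a) = star (toAlgPartialAction.act t a)

variable {G A}

/-- An (increasing) approximate unit of the closed ideal `I`: an increasing net of positive
elements of norm at most `1` with `lim_i ‖u_i x - x‖ = 0` for all `x ∈ I`. -/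
structure IsApproxUnit [PartialOrder A] [StarOrderedRing A] {ι : Type x} [Preorder ι]
    (I : Submodule ℂ A) (u : ι → A) : Prop where
  mem : ∀ i, u i ∈ I
  nonneg : ∀ i, 0 ≤ u i
  norm_le_one : ∀ i, ‖u i‖ ≤ 1
  mono : Monotone u
  approx : ∀ x ∈ I, Filter.Tendsto (fun i => ‖u i * x - x‖) Filter.atTop (nhds 0)

/-- Property (NS): for all `a, b ∈ A`, `t ∈ G` and every approximate unit `(u_i)` of
`A_{t⁻¹}`, the net `(α_t(u_i a) b)` converges in `A`. -/
def HasNS [PartialOrder A] [StarOrderedRing A] (α : CStarPartialAction G A) : Prop :=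
  ∀ (t : G) (a b : A) (ι : Type v) [Preorder ι] [IsDirected ι (· ≤ ·)] [Nonempty ι],
    ∀ u : ι → A, IsApproxUnit (α.ideal t⁻¹) u →
      ∃ x : A, Filter.Tendsto (fun i => α.act t (u i * a) * b) Filter.atTop (nhds x)

/-- A C*-enveloping pair `(μ, β)` for a C*-partial action `α` of a discrete group. -/
structure CStarEnvPair (α : CStarPartialAction G A) (B : Type w) [NonUnitalCStarAlgebra B] :
    Type (max u v w) where
  β : G → B →ₙₐ[ℂ] B
  β_star : ∀ (t : G) (b : B), β t (star b) = star (β t b)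
  β_one : ∀ b : B, β 1 b = b
  β_comp : ∀ (s t : G) (b : B), β (s * t) b = β s (β t b)
  μ : A →ₙₐ[ℂ] B
  μ_star : ∀ a : A, μ (star a) = star (μ a)
  μ_inj : Function.Injective μ
  range_closed : IsClosed (Set.range μ)
  μ_mul_mem_left : ∀ b : B, ∀ x ∈ Set.range μ, b * x ∈ Set.range μ
  μ_mul_mem_right : ∀ b : B, ∀ x ∈ Set.range μ, x * b ∈ Set.range μ
  inter : ∀ t : G, ⇑μ '' (α.ideal t : Set A) = Set.range μ ∩ (⇑(β t) '' Set.range μ)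
  equivar : ∀ t : G, ∀ a ∈ α.ideal t⁻¹, β t (μ a) = μ (α.act t a)
  dense_span : Dense
    ((Submodule.span ℂ (⋃ t : G, ⇑(β t) '' Set.range μ) : Submodule ℂ B) : Set B)

end CStarPrelim

section ClosedIdeals

open Filter Topology

variable {A : Type v} [NonUnitalCStarAlgebra A]

/-- The range of an isometric *-homomorphism has an approximate unit indexed by a type in the
universe of its domain. -/
lemma NonUnitalStarAlgHom.exists_isApproxUnit [PartialOrder A] [StarOrderedRing A]
    {B : Type v} [NonUnitalCStarAlgebra B] (φ : B →⋆ₙₐ[ℂ] A) (hφ : ∀ x, ‖φ x‖ = ‖x‖)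
    {I : Submodule ℂ A} (hI : ∀ x, x ∈ I ↔ x ∈ Set.range φ) :
    ∃ (ι : Type v) (_ : Preorder ι) (_ : IsDirected ι (· ≤ ·)) (_ : Nonempty ι) (u : ι → A),
      IsApproxUnit I u := by
  let _ : PartialOrder B := CStarAlgebra.spectralOrder B
  have : StarOrderedRing B := CStarAlgebra.spectralOrderedRing B
  have hdir : IsDirected {x : B // 0 ≤ x ∧ ‖x‖ < 1} (· ≤ ·) := by
    refine ⟨fun x y => ?_⟩
    obtain ⟨z, hz, hxz, hyz⟩ := CStarAlgebra.directedOn_nonneg_ball (x : B)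
      (by simpa using x.2) (y : B) (by simpa using y.2)
    exact ⟨⟨z, by simpa using hz⟩, hxz, hyz⟩
  have hne : Nonempty {x : B // 0 ≤ x ∧ ‖x‖ < 1} := ⟨⟨0, by simp⟩⟩
  have hmono : Monotone φ := OrderHomClass.mono φ
  have htend : Tendsto (Subtype.val : {x : B // 0 ≤ x ∧ ‖x‖ < 1} → B) atTop
      (CStarAlgebra.approximateUnit B) := by
    rw [(CStarAlgebra.hasBasis_approximateUnit B).tendsto_right_iff]
    intro x hx
    filter_upwards [eventually_ge_atTop (⟨x, hx⟩ : {x : B // 0 ≤ x ∧ ‖x‖ < 1})] with y hy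
    exact ⟨hy, by simpa using y.2.2.le⟩
  refine ⟨{x : B // 0 ≤ x ∧ ‖x‖ < 1}, inferInstance, hdir, hne, fun x => φ x,
    fun x => (hI _).mpr ⟨x, rfl⟩, fun x => ?_, fun x => (hφ x).trans_le x.2.2.le,
    fun x y hxy => hmono hxy, fun x hx => ?_⟩
  · simpa using hmono x.2.1
  · obtain ⟨b, rfl⟩ := (hI x).mp hx
    have h := ((CStarAlgebra.increasingApproximateUnit B).tendsto_mul_right b).comp htend
    rw [tendsto_iff_norm_sub_tendsto_zero] at h
    simpa only [← map_mul, ← map_sub, hφ, Function.comp_apply] using h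

/-- A C*-subalgebra has an approximate unit indexed by a type in the universe of the algebra. -/
lemma NonUnitalStarSubalgebra.exists_isApproxUnit [PartialOrder A] [StarOrderedRing A]
    (S : NonUnitalStarSubalgebra ℂ A) (hS : IsClosed (S : Set A)) :
    ∃ (ι : Type v) (_ : Preorder ι) (_ : IsDirected ι (· ≤ ·)) (_ : Nonempty ι) (u : ι → A),
      IsApproxUnit S.toNonUnitalSubalgebra.toSubmodule u := by
  have : IsClosed (S : Set A) := hS
  exact NonUnitalStarAlgHom.exists_isApproxUnit (NonUnitalStarSubalgebraClass.subtype S)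
    (fun _ => rfl) fun x => ⟨fun hx => ⟨⟨x, hx⟩, rfl⟩, fun ⟨y, hy⟩ => hy ▸ y.2⟩

/-- A closed two-sided ideal of a C*-algebra is self-adjoint. -/
lemma Submodule.star_mem_of_isClosed_of_mul_mem (I : Submodule ℂ A)
    (hl : ∀ a : A, ∀ x ∈ I, a * x ∈ I) (hr : ∀ a : A, ∀ x ∈ I, x * a ∈ I)
    (hI : IsClosed (I : Set A)) {a : A} (ha : a ∈ I) : star a ∈ I := by
  let _ : PartialOrder A := CStarAlgebra.spectralOrder A
  have : StarOrderedRing A := CStarAlgebra.spectralOrderedRing A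
  let S : NonUnitalStarSubalgebra ℂ A :=
    { carrier := {x | x ∈ I ∧ star x ∈ I}
      add_mem' := fun hx hy => ⟨I.add_mem hx.1 hy.1, by simpa using I.add_mem hx.2 hy.2⟩
      zero_mem' := by simp
      mul_mem' := fun hx hy => ⟨hl _ _ hy.1, by simpa using hl _ _ hx.2⟩
      smul_mem' := fun c x hx => ⟨I.smul_mem c hx.1, by simpa using I.smul_mem _ hx.2⟩
      star_mem' := fun hx => ⟨hx.2, by simpa using hx.1⟩ }
  have hS : IsClosed (S : Set A) := hI.inter (hI.preimage continuous_star)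
  obtain ⟨ι, _, _, _, u, hu⟩ := S.exists_isApproxUnit hS
  have hmem : star a * a ∈ S.toNonUnitalSubalgebra.toSubmodule :=
    ⟨hl _ _ ha, by simpa using hl _ _ ha⟩
  have hbound : ∀ i, ‖u i * star a - star a‖ ^ 2 ≤ 2 * ‖u i * (star a * a) - star a * a‖ := by
    intro i
    have hs : star (u i) = u i := (hu.nonneg i).isSelfAdjoint.star_eq
    set z := u i * (star a * a) - star a * a with hz
    have hprod : (u i * star a - star a) * star (u i * star a - star a) = z * u i - z := by
      simp only [star_sub, star_mul, star_star, hs, hz]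
      noncomm_ring
    calc ‖u i * star a - star a‖ ^ 2 = ‖z * u i - z‖ := by
          rw [← hprod, CStarRing.norm_self_mul_star, sq]
      _ ≤ ‖z‖ * ‖u i‖ + ‖z‖ := (norm_sub_le _ _).trans (by gcongr; exact norm_mul_le _ _)
      _ ≤ 2 * ‖z‖ := by nlinarith [norm_nonneg z, hu.norm_le_one i]
  have hsq : Tendsto (fun i => ‖u i * star a - star a‖ ^ 2) atTop (𝓝 0) :=
    squeeze_zero (fun _ => by positivity) hbound
      (by simpa using (hu.approx _ hmem).const_mul 2)
  have hlim : Tendsto (fun i => u i * star a) atTop (𝓝 (star a)) := by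
    rw [tendsto_iff_norm_sub_tendsto_zero]
    simpa using hsq.sqrt
  exact hI.mem_of_tendsto hlim (Eventually.of_forall fun i => hr _ _ (hu.mem i).1)

/-- An element of a self-adjoint set is determined by the products with the set on its left. -/
lemma eq_of_forall_mem_mul_eq {I : Submodule ℂ A} (hstar : ∀ x ∈ I, star x ∈ I) {z w : A}
    (hz : z ∈ I) (hw : w ∈ I) (h : ∀ x ∈ I, x * z = x * w) : z = w := by
  rw [← sub_eq_zero, ← CStarRing.star_mul_self_eq_zero_iff, mul_sub, sub_eq_zero]
  exact h _ (hstar _ (I.sub_mem hz hw))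

end ClosedIdeals

namespace CStarPartialAction

open Filter Topology

variable {G : Type u} [Group G] {A : Type v} [NonUnitalCStarAlgebra A]
  (α : CStarPartialAction G A)

lemma star_mem {t : G} {x : A} (hx : x ∈ α.ideal t) : star x ∈ α.ideal t :=
  (α.ideal t).star_mem_of_isClosed_of_mul_mem (α.mul_mem_left t) (α.mul_mem_right t)
    (α.ideal_closed t) hx

/-- The ideal `A_t` as a C*-subalgebra. -/
def idealStarSubalgebra (t : G) : NonUnitalStarSubalgebra ℂ A where
  __ := α.ideal t
  mul_mem' := fun {a _} _ hb => α.mul_mem_left t a _ hb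
  star_mem' := α.star_mem

/-- The partial map `α_t`, as a *-homomorphism on `A_{t⁻¹}`. -/
def actStarHom (t : G) : α.idealStarSubalgebra t⁻¹ →⋆ₙₐ[ℂ] A where
  toFun x := α.act t x
  map_smul' c x := α.act_smul t c x x.2
  map_zero' := by
    have h := α.act_smul t 0 0 (α.ideal t⁻¹).zero_mem
    simpa using h
  map_add' x y := α.act_add t x x.2 y y.2
  map_mul' x y := α.act_mul t x x.2 y y.2
  map_star' x := α.act_star t x x.2

lemma continuousOn_act (t : G) : ContinuousOn (α.act t) (α.ideal t⁻¹) := by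
  have : IsClosed (α.idealStarSubalgebra t⁻¹ : Set A) := α.ideal_closed t⁻¹
  rw [continuousOn_iff_continuous_domRestrict]
  exact AddMonoidHomClass.continuous_of_bound (α.actStarHom t) 1 fun x => by
    simpa using NonUnitalStarAlgHom.norm_apply_le (α.actStarHom t) x

lemma act_act_inv {t : G} {x : A} (hx : x ∈ α.ideal t) : α.act t (α.act t⁻¹ x) = x := by
  have hx' : x ∈ α.ideal t⁻¹⁻¹ := by rwa [inv_inv]
  rw [α.act_comp t t⁻¹ x hx' (α.act_mem t⁻¹ x hx'), mul_inv_cancel, α.act_one]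

lemma act_inv_mem {t : G} {x : A} (hx : x ∈ α.ideal t) : α.act t⁻¹ x ∈ α.ideal t⁻¹ :=
  α.act_mem t⁻¹ x (by rwa [inv_inv])

lemma act_mem_mul {s t : G} {x : A} (hx : x ∈ α.ideal t⁻¹) (hxs : x ∈ α.ideal s) :
    α.act t x ∈ α.ideal (t * s) := by
  have h : α.act t x ∈ α.act t '' ((α.ideal t⁻¹ : Set A) ∩ (α.ideal s : Set A)) :=
    ⟨x, ⟨hx, hxs⟩, rfl⟩
  rw [α.act_image] at h
  exact h.2

lemma act_inv_mem_mul {s t : G} {x : A} (hx : x ∈ α.ideal t) (hxs : x ∈ α.ideal s) :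
    α.act t⁻¹ x ∈ α.ideal (t⁻¹ * s) :=
  α.act_mem_mul (by rwa [inv_inv]) hxs

/-- If `x ∈ A_t ∩ A_{ts}` and `y = α_{t⁻¹}(x)`, then `α_{(ts)⁻¹}(x) = α_{s⁻¹}(y)`. -/
lemma act_mul_inv_apply {s t : G} {x : A}
    (hx : x ∈ α.ideal t) (hx' : x ∈ α.ideal (t * s)) :
    α.act (t * s)⁻¹ x = α.act s⁻¹ (α.act t⁻¹ x) := by
  have h : α.act t⁻¹ x ∈ α.ideal s := by simpa using α.act_inv_mem_mul hx hx'
  rw [α.act_comp s⁻¹ t⁻¹ x (by rwa [inv_inv]) (by rwa [inv_inv]), mul_inv_rev]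

/-- `a ∈ A_t` as soon as `a c ∈ A_t` for all `c ∈ A`. -/
lemma mem_of_forall_mul_mem {t : G} {a : A}
    (h : ∀ c, a * c ∈ α.ideal t) : a ∈ α.ideal t := by
  let _ : PartialOrder A := CStarAlgebra.spectralOrder A
  have : StarOrderedRing A := CStarAlgebra.spectralOrderedRing A
  exact (α.ideal_closed t).mem_of_tendsto
    ((CStarAlgebra.increasingApproximateUnit A).tendsto_mul_left a) (Eventually.of_forall h)

/-- Two elements of `A_s ∩ A_t` agree if all their left products with `A_s ∩ A_t` agree. -/
lemma eq_of_forall_mem_inter {s t : G} {z w : A} (hz : z ∈ α.ideal s) (hz' : z ∈ α.ideal t)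
    (hw : w ∈ α.ideal s) (hw' : w ∈ α.ideal t)
    (h : ∀ x ∈ α.ideal s, x ∈ α.ideal t → x * z = x * w) : z = w :=
  eq_of_forall_mem_mul_eq (I := α.ideal s ⊓ α.ideal t)
    (fun _ hx => ⟨α.star_mem hx.1, α.star_mem hx.2⟩) ⟨hz, hz'⟩ ⟨hw, hw'⟩
    fun x hx => h x hx.1 hx.2

lemma eq_of_forall_mem {t : G} {z w : A} (hz : z ∈ α.ideal t) (hw : w ∈ α.ideal t)
    (h : ∀ x ∈ α.ideal t, x * z = x * w) : z = w :=
  α.eq_of_forall_mem_inter hz hz hw hw fun x hx _ => h x hx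

lemma exists_isApproxUnit [PartialOrder A] [StarOrderedRing A] (t : G) :
    ∃ (ι : Type v) (_ : Preorder ι) (_ : IsDirected ι (· ≤ ·)) (_ : Nonempty ι) (u : ι → A),
      IsApproxUnit (α.ideal t) u :=
  (α.idealStarSubalgebra t).exists_isApproxUnit (α.ideal_closed t)

/-- The defining property of the limits: `F_t(a,b)` is the limit of `α_t(u_i a) b` for every
approximate unit `(u_i)` of `A_{t⁻¹}`. -/
def IsLimitFamily [PartialOrder A] [StarOrderedRing A] (F : G → A → A → A) : Prop :=
  ∀ (t : G) (a b : A) (ι : Type v) [Preorder ι] [IsDirected ι (· ≤ ·)] [Nonempty ι],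
    ∀ u : ι → A, IsApproxUnit (α.ideal t⁻¹) u →
      Tendsto (fun i => α.act t (u i * a) * b) atTop (𝓝 (F t a b))

namespace IsLimitFamily

variable {α} [PartialOrder A] [StarOrderedRing A] {F : G → A → A → A}

/-- A closed set containing all `α_t(u a) b` with `u ∈ A_{t⁻¹}` contains `F_t(a,b)`. -/
lemma mem_of_forall_mem (hF : α.IsLimitFamily F) {t : G} {a b : A} {C : Set A}
    (hC : IsClosed C) (h : ∀ u ∈ α.ideal t⁻¹, α.act t (u * a) * b ∈ C) : F t a b ∈ C := by
  obtain ⟨ι, _, _, _, u, hu⟩ := α.exists_isApproxUnit t⁻¹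
  exact hC.mem_of_tendsto (hF t a b ι u hu) (Eventually.of_forall fun i => h _ (hu.mem i))

lemma mem (hF : α.IsLimitFamily F) (t : G) (a b : A) : F t a b ∈ α.ideal t :=
  hF.mem_of_forall_mem (α.ideal_closed t) fun u hu =>
    α.mul_mem_right _ _ _ (α.act_mem t _ (α.mul_mem_right _ _ _ hu))

lemma mem_of_right_mem (hF : α.IsLimitFamily F) {s : G} (t : G) (a : A) {b : A}
    (hb : b ∈ α.ideal s) : F t a b ∈ α.ideal s :=
  hF.mem_of_forall_mem (α.ideal_closed s) fun _ _ => α.mul_mem_left _ _ _ hb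

lemma mem_of_left_mem (hF : α.IsLimitFamily F) {s : G} (t : G) {a : A} (b : A)
    (ha : a ∈ α.ideal s) : F t a b ∈ α.ideal (t * s) :=
  hF.mem_of_forall_mem (α.ideal_closed _) fun _ hu =>
    α.mul_mem_right _ _ _ (α.act_mem_mul (α.mul_mem_right _ _ _ hu) (α.mul_mem_left _ _ _ ha))

/-- `α_t(y) F_t(a,b) = α_t(y a) b` for `y ∈ A_{t⁻¹}`. -/
lemma act_mul_apply (hF : α.IsLimitFamily F) {t : G} (a b : A) {y : A} (hy : y ∈ α.ideal t⁻¹) :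
    α.act t y * F t a b = α.act t (y * a) * b := by
  obtain ⟨ι, _, _, _, u, hu⟩ := α.exists_isApproxUnit t⁻¹
  have hyu : Tendsto (fun i => y * u i) atTop (𝓝 y) := by
    have h := tendsto_iff_norm_sub_tendsto_zero.mpr (hu.approx _ (α.star_mem hy))
    simpa [(hu.nonneg _).isSelfAdjoint.star_eq] using h.star
  have hya : Tendsto (fun i => y * u i * a) atTop (𝓝[α.ideal t⁻¹] (y * a)) :=
    tendsto_nhdsWithin_iff.mpr ⟨hyu.mul_const a,
      Eventually.of_forall fun i => α.mul_mem_right _ _ _ (α.mul_mem_right _ _ _ hy)⟩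
  have h₁ := ((α.continuousOn_act t _ (α.mul_mem_right _ a _ hy)).tendsto.comp hya).mul_const b
  have h₂ := (hF t a b ι u hu).const_mul (α.act t y)
  refine tendsto_nhds_unique h₂ (h₁.congr fun i => ?_)
  rw [Function.comp_apply, mul_assoc y, α.act_mul t y hy _ (α.mul_mem_right _ _ _ (hu.mem i)),
    mul_assoc]

/-- `x F_t(a,b) = α_t(α_{t⁻¹}(x) a) b` for `x ∈ A_t`. -/
lemma mul_apply (hF : α.IsLimitFamily F) {t : G} (a b : A) {x : A} (hx : x ∈ α.ideal t) :
    x * F t a b = α.act t (α.act t⁻¹ x * a) * b := by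
  rw [← hF.act_mul_apply a b (α.act_inv_mem hx), α.act_act_inv hx]

lemma inv_mem (hF : α.IsLimitFamily F) (t : G) (a b : A) : α.act t (F t⁻¹ a b) ∈ α.ideal t :=
  α.act_mem t _ (hF.mem _ _ _)

/-- `x α_t(F_{t⁻¹}(a,b)) = α_t(α_{t⁻¹}(x a) b)` for `x ∈ A_t`. -/
lemma mul_act_apply_inv (hF : α.IsLimitFamily F) {t : G} (a b : A) {x : A}
    (hx : x ∈ α.ideal t) :
    x * α.act t (F t⁻¹ a b) = α.act t (α.act t⁻¹ (x * a) * b) := by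
  rw [← hF.act_mul_apply (t := t⁻¹) a b (by rwa [inv_inv]),
    α.act_mul t _ (α.act_inv_mem hx) _ (hF.mem _ _ _), α.act_act_inv hx]

/-- `F_t(a,b) = α_t(a α_{t⁻¹}(b))` for `b ∈ A_t`. -/
lemma apply_of_mem (hF : α.IsLimitFamily F) {t : G} (a : A) {b : A} (hb : b ∈ α.ideal t) :
    F t a b = α.act t (a * α.act t⁻¹ b) := by
  have hb' := α.act_inv_mem hb
  have hab := α.mul_mem_left _ a _ hb'
  refine α.eq_of_forall_mem (hF.mem _ _ _) (α.act_mem t _ hab) fun x hx => ?_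
  have hx' := α.act_inv_mem hx
  conv_rhs => rw [← α.act_act_inv hx]
  rw [hF.mul_apply a b hx, ← α.act_mul t _ hx' _ hab, ← mul_assoc,
    α.act_mul t _ (α.mul_mem_right _ a _ hx') _ hb', α.act_act_inv hb]

lemma apply_mul (hF : α.IsLimitFamily F) (t : G) (a b c : A) : F t a (b * c) = F t a b * c :=
  α.eq_of_forall_mem (hF.mem _ _ _) (α.mul_mem_right _ _ _ (hF.mem _ _ _)) fun x hx => by
    rw [← mul_assoc, hF.mul_apply _ _ hx, hF.mul_apply _ _ hx, mul_assoc]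

lemma star_apply (hF : α.IsLimitFamily F) (t : G) (a b : A) :
    star (F t a b) = α.act t (F t⁻¹ (star b) (star a)) := by
  refine α.eq_of_forall_mem (α.star_mem (hF.mem _ _ _)) (hF.inv_mem _ _ _) fun x hx => ?_
  have hbx : b * star x ∈ α.ideal t := α.mul_mem_left _ _ _ (α.star_mem hx)
  have hbx' := α.act_inv_mem hbx
  calc x * star (F t a b) = star (F t a b * star x) := by simp
    _ = star (α.act t (a * α.act t⁻¹ (b * star x))) := by
      rw [← hF.apply_mul, hF.apply_of_mem a hbx]
    _ = α.act t (α.act t⁻¹ (x * star b) * star a) := by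
      rw [← α.act_star t _ (α.mul_mem_left _ _ _ hbx'), star_mul,
        ← α.act_star t⁻¹ _ (by rwa [inv_inv])]
      simp
    _ = x * α.act t (F t⁻¹ (star b) (star a)) := (hF.mul_act_apply_inv _ _ hx).symm

lemma add_left (hF : α.IsLimitFamily F) (t : G) (a a' b : A) :
    F t (a + a') b = F t a b + F t a' b :=
  α.eq_of_forall_mem (hF.mem _ _ _) ((α.ideal t).add_mem (hF.mem _ _ _) (hF.mem _ _ _))
    fun x hx => by
      have hx' := α.act_inv_mem hx
      rw [mul_add, hF.mul_apply _ _ hx, hF.mul_apply _ _ hx, hF.mul_apply _ _ hx, mul_add,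
        α.act_add t _ (α.mul_mem_right _ _ _ hx') _ (α.mul_mem_right _ _ _ hx'), add_mul]

lemma add_right (hF : α.IsLimitFamily F) (t : G) (a b b' : A) :
    F t a (b + b') = F t a b + F t a b' :=
  α.eq_of_forall_mem (hF.mem _ _ _) ((α.ideal t).add_mem (hF.mem _ _ _) (hF.mem _ _ _))
    fun x hx => by
      rw [mul_add, hF.mul_apply _ _ hx, hF.mul_apply _ _ hx, hF.mul_apply _ _ hx, mul_add]

lemma smul_left (hF : α.IsLimitFamily F) (t : G) (c : ℂ) (a b : A) :
    F t (c • a) b = c • F t a b :=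
  α.eq_of_forall_mem (hF.mem _ _ _) ((α.ideal t).smul_mem c (hF.mem _ _ _)) fun x hx => by
    rw [mul_smul_comm, hF.mul_apply _ _ hx, hF.mul_apply _ _ hx, mul_smul_comm,
      α.act_smul t c _ (α.mul_mem_right _ _ _ (α.act_inv_mem hx)), smul_mul_assoc]

lemma smul_right (hF : α.IsLimitFamily F) (t : G) (c : ℂ) (a b : A) :
    F t a (c • b) = c • F t a b :=
  α.eq_of_forall_mem (hF.mem _ _ _) ((α.ideal t).smul_mem c (hF.mem _ _ _)) fun x hx => by
    rw [mul_smul_comm, hF.mul_apply _ _ hx, hF.mul_apply _ _ hx, mul_smul_comm]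

lemma apply_one (hF : α.IsLimitFamily F) (a b : A) : F 1 a b = a * b := by
  have hmem : ∀ x : A, x ∈ α.ideal 1 := fun x => by simp [α.ideal_one]
  refine α.eq_of_forall_mem (t := 1) (hmem _) (hmem _) fun x hx => ?_
  rw [hF.mul_apply _ _ hx, inv_one, α.act_one, α.act_one, mul_assoc]

lemma act_mul_left (hF : α.IsLimitFamily F) (t : G) (a b c : A) :
    α.act t (F t⁻¹ (a * b) c) = a * α.act t (F t⁻¹ b c) :=
  α.eq_of_forall_mem (hF.inv_mem _ _ _) (α.mul_mem_left _ _ _ (hF.inv_mem _ _ _))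
    fun x hx => by
      rw [hF.mul_act_apply_inv _ _ hx, ← mul_assoc, ← mul_assoc,
        hF.mul_act_apply_inv _ _ (α.mul_mem_right _ a _ hx)]

lemma mul_apply_eq_act_mul (hF : α.IsLimitFamily F) (t : G) (a b c : A) :
    a * F t b c = α.act t (F t⁻¹ a b) * c :=
  α.eq_of_forall_mem (α.mul_mem_left _ _ _ (hF.mem _ _ _))
    (α.mul_mem_right _ _ _ (hF.inv_mem _ _ _)) fun x hx => by
      rw [← mul_assoc, hF.mul_apply _ _ (α.mul_mem_right _ a _ hx), ← mul_assoc,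
        hF.mul_act_apply_inv _ _ hx]

lemma apply_apply_left (hF : α.IsLimitFamily F) (s t : G) (a b c : A) :
    F t (F s a b) c = F (t * s) a (F t b c) := by
  refine α.eq_of_forall_mem_inter (hF.mem _ _ _) (hF.mem_of_left_mem _ _ (hF.mem _ _ _))
    (hF.mem_of_right_mem _ _ (hF.mem _ _ _)) (hF.mem _ _ _) fun x hx hx' => ?_
  have hys : α.act t⁻¹ x ∈ α.ideal s := by simpa using α.act_inv_mem_mul hx hx'
  have hyt := α.act_inv_mem hx
  have hws := α.act_inv_mem hys
  have hwst := α.act_inv_mem_mul hys hyt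
  have hz : α.act s (α.act s⁻¹ (α.act t⁻¹ x) * a) ∈ α.ideal t⁻¹ := by
    simpa using α.act_mem_mul (α.mul_mem_right _ a _ hws) (α.mul_mem_right _ a _ hwst)
  rw [hF.mul_apply _ _ hx, hF.mul_apply _ _ hys, hF.mul_apply _ _ hx',
    α.act_mul_inv_apply hx hx', ← α.act_comp t s _ (α.mul_mem_right _ a _ hws) hz,
    hF.act_mul_apply b c hz]

lemma apply_act_apply (hF : α.IsLimitFamily F) (r t : G) (a b c : A) :
    F t (α.act r (F r⁻¹ a b)) c = F t a (F (t * r) b c) := by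
  refine α.eq_of_forall_mem_inter (hF.mem _ _ _) (hF.mem_of_left_mem _ _ (hF.inv_mem r _ _))
    (hF.mem _ _ _) (hF.mem_of_right_mem _ _ (hF.mem _ _ _)) fun x hx hx' => ?_
  have hyr : α.act t⁻¹ x ∈ α.ideal r := by simpa using α.act_inv_mem_mul hx hx'
  have hyt := α.act_inv_mem hx
  have hyar := α.mul_mem_right _ a _ hyr
  have hyat := α.mul_mem_right _ a _ hyt
  have hwr := α.act_inv_mem hyar
  have hwt : α.act r⁻¹ (α.act t⁻¹ x * a) ∈ α.ideal (t * r)⁻¹ := by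
    simpa using α.act_inv_mem_mul hyar hyat
  have hcomp : ∀ d, α.act t (α.act r (α.act r⁻¹ (α.act t⁻¹ x * a) * d)) =
      α.act (t * r) (α.act r⁻¹ (α.act t⁻¹ x * a) * d) := fun d =>
    α.act_comp t r _ (α.mul_mem_right _ _ _ hwr) (by
      simpa using α.act_mem_mul (α.mul_mem_right _ d _ hwr) (α.mul_mem_right _ d _ hwt))
  have hcomp' : α.act t (α.act t⁻¹ x * a) = α.act (t * r) (α.act r⁻¹ (α.act t⁻¹ x * a)) := by
    rw [← α.act_comp t r _ hwr (by rwa [α.act_act_inv hyar]), α.act_act_inv hyar]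
  rw [hF.mul_apply _ _ hx, hF.mul_act_apply_inv _ _ hyr, hF.mul_apply _ _ hx, hcomp, hcomp',
    hF.act_mul_apply b c hwt]

lemma apply_mul_index (hF : α.IsLimitFamily F) (s t : G) (b : A) {a : A}
    (ha : a ∈ α.ideal t⁻¹) : F (s * t) a b = F s (α.act t a) b := by
  refine α.eq_of_forall_mem_inter (s := s) (t := s * t)
    (by simpa using hF.mem_of_left_mem (s * t) b ha) (hF.mem _ _ _) (hF.mem _ _ _)
    (hF.mem_of_left_mem _ _ (α.act_mem t a ha)) fun x hx hx' => ?_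
  have hyt : α.act s⁻¹ x ∈ α.ideal t := by simpa using α.act_inv_mem_mul hx hx'
  have hys := α.act_inv_mem hx
  have hwt := α.act_inv_mem hyt
  have hact : α.act s⁻¹ x * α.act t a = α.act t (α.act t⁻¹ (α.act s⁻¹ x) * a) := by
    rw [α.act_mul t _ hwt _ ha, α.act_act_inv hyt]
  rw [hF.mul_apply _ _ hx', hF.mul_apply _ _ hx, α.act_mul_inv_apply hx hx', hact,
    α.act_comp s t _ (α.mul_mem_right _ _ _ hwt)
      (by rw [← hact]; exact α.mul_mem_right _ _ _ hys)]

lemma act_apply_inv_mul_index (hF : α.IsLimitFamily F) (s t : G) (b : A) {a : A}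
    (ha : a ∈ α.ideal t⁻¹) :
    α.act (s * t) (F (s * t)⁻¹ b a) = α.act s (F s⁻¹ b (α.act t a)) := by
  refine α.eq_of_forall_mem_inter (s := s) (t := s * t)
    (by simpa using α.act_mem_mul (hF.mem (s * t)⁻¹ b a) (hF.mem_of_right_mem _ b ha))
    (hF.inv_mem _ _ _) (hF.inv_mem _ _ _)
    (α.act_mem_mul (hF.mem _ _ _) (hF.mem_of_right_mem _ _ (α.act_mem t a ha)))
    fun x hx hx' => ?_
  have hb := α.mul_mem_right _ b _ hx
  have hb' := α.mul_mem_right _ b _ hx'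
  have hyt : α.act s⁻¹ (x * b) ∈ α.ideal t := by simpa using α.act_inv_mem_mul hb hb'
  have hys := α.act_inv_mem hb
  have hwt := α.act_inv_mem hyt
  have hact : α.act s⁻¹ (x * b) * α.act t a =
      α.act t (α.act t⁻¹ (α.act s⁻¹ (x * b)) * a) := by
    rw [α.act_mul t _ hwt _ ha, α.act_act_inv hyt]
  rw [hF.mul_act_apply_inv _ _ hx', hF.mul_act_apply_inv _ _ hx, α.act_mul_inv_apply hb hb',
    hact, α.act_comp s t _ (α.mul_mem_right _ _ _ hwt)
      (by rw [← hact]; exact α.mul_mem_right _ _ _ hys)]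

end IsLimitFamily

end CStarPartialAction

/-- If `α` has property (NS) and `F_t(a,b)` is defined as the limit
`lim_i α_t(u_i a) b` over (any) approximate unit of `A_{t⁻¹}`, then `(F_t)_{t∈G}` is an
enveloping family of functions for `α`; in particular
`F_t(a,b)* = α_t(F_{t⁻¹}(b*, a*))` for all `a, b ∈ A` and `t ∈ G`. -/
theorem NS_limits_form_envFamily
    {G : Type u} [Group G] {A : Type v} [NonUnitalCStarAlgebra A]
    [PartialOrder A] [StarOrderedRing A]
    (α : CStarPartialAction G A) (hNS : HasNS α)
    (F : G → A → A → A)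
    (hF : ∀ (t : G) (a b : A) (ι : Type v) [Preorder ι] [IsDirected ι (· ≤ ·)] [Nonempty ι],
      ∀ u : ι → A, IsApproxUnit (α.ideal t⁻¹) u →
        Filter.Tendsto (fun i => α.act t (u i * a) * b) Filter.atTop (nhds (F t a b))) :
    IsEnvFamily α.toAlgPartialAction F ∧
      ∀ (t : G) (a b : A), star (F t a b) = α.act t (F t⁻¹ (star b) (star a)) := by
  replace hF : α.IsLimitFamily F := hF
  refine ⟨{
    mem := hF.mem
    add_left := hF.add_left
    add_right := hF.add_right
    smul_left := hF.smul_left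
    smul_right := hF.smul_right
    F_one := hF.apply_one
    cond2a := hF.apply_mul
    cond2b := hF.act_mul_left
    cond2c := hF.mul_apply_eq_act_mul
    cond3a := hF.apply_apply_left
    cond3b := fun s t a b c => by simpa using hF.apply_act_apply s⁻¹ t a b c
    cond4 := fun a => ⟨?_, fun h => ?_⟩
    cond5a := fun s t b a ha => hF.apply_mul_index s t b ha
    cond5b := fun s t b a ha => by simpa using hF.act_apply_inv_mul_index s t b ha
    cond6 := ?_ }, hF.star_apply⟩
  · rintro rfl t b
    exact ⟨by simpa using hF.smul_left t 0 0 b, by simpa using hF.smul_right t 0 b 0⟩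
  · rw [← CStarRing.mul_star_self_eq_zero_iff, ← hF.apply_one]
    exact (h 1 (star a)).1
  · rintro t a ⟨b, hb⟩
    refine α.mem_of_forall_mul_mem fun c => ?_
    rw [← hF.apply_one, (hb 1 c).1, one_mul]
    exact hF.mem t b c
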